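/- For a non-degenerate best-k scoring rule, for every voter i and every collection A_{-i} of the other voters' ballots, there exists a ballot A_i ⊆ C that is both sincere and a best response (BR) to A_{-i}. -/

import Mathlib

open Finset

/-- The 0-indexed rank of candidate `c` within committee `W` with respect to the utility `u`:
the number of members of `W` strictly preferred to `c`.  Thus the most preferred member of `W`
has rank `0`. -/
noncomputable def owaRank {C : Type*} (u : C → ℝ) (W : Finset C) (c : C) : ℕ :=
  (W.filter fun c' => u c < u c').card

/-- The OWA set-extension utility determined by the weights `lam` (where `lam 0` is the weight
`λ₁` put on the most preferred committee member, `lam 1` is `λ₂`, and so on) and the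
utility function `u`. -/
noncomputable def owaUtil {C : Type*} (lam : ℕ → ℝ) (u : C → ℝ) (W : Finset C) : ℝ :=
  ∑ c ∈ W, lam (owaRank u W c) * u c

/-- The approval score of candidate `c` under the ballot profile `A`. -/
def score {N C : Type*} [Fintype N] [DecidableEq C] (A : N → Finset C) (c : C) : ℕ :=
  (Finset.univ.filter fun i => c ∈ A i).card

/-- Candidate `c` is ranked above candidate `c'` by the best-`k` scoring rule with scoring
function `g`, with ties broken by the priority order: `c < c'` means `c` has higher
priority (`c ▷ c'`). -/
def beats {N C : Type*} [Fintype N] [DecidableEq C] [LT C]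
    (g : C → ℕ → ℝ) (A : N → Finset C) (c c' : C) : Prop :=
  g c' (score A c') < g c (score A c) ∨
    (g c (score A c) = g c' (score A c') ∧ c < c')

open Classical in
/-- The winning committee: the `k` top-ranked candidates. -/
noncomputable def winners {N C : Type*} [Fintype N] [Fintype C] [DecidableEq C] [LT C]
    (g : C → ℕ → ℝ) (k : ℕ) (A : N → Finset C) : Finset C :=
  Finset.univ.filter fun c => (Finset.univ.filter fun c' => beats g A c' c).card < k

/-- `B` is a best-response ballot of voter `i` against the other voters' ballots in `A`. -/
def BestResponse {N C : Type*} [Fintype N] [DecidableEq N] [Fintype C] [DecidableEq C] [LT C]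
    (g : C → ℕ → ℝ) (k : ℕ) (lam : ℕ → ℝ) (u : C → ℝ)
    (A : N → Finset C) (i : N) (B : Finset C) : Prop :=
  ∀ B' : Finset C,
    owaUtil lam u (winners g k (Function.update A i B')) ≤
      owaUtil lam u (winners g k (Function.update A i B))

/-- `B` is a minimal best-response ballot of voter `i`. -/
def MinimalBestResponse {N C : Type*} [Fintype N] [DecidableEq N] [Fintype C] [DecidableEq C]
    [LT C] (g : C → ℕ → ℝ) (k : ℕ) (lam : ℕ → ℝ) (u : C → ℝ)
    (A : N → Finset C) (i : N) (B : Finset C) : Prop :=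
  BestResponse g k lam u A i B ∧
    ∀ B' : Finset C, BestResponse g k lam u A i B' → B.card ≤ B'.card

/-- A ballot profile is a lazy pure Nash equilibrium if every voter's ballot is a minimal
best response to the other voters' ballots. -/
def LazyPNE {N C : Type*} [Fintype N] [DecidableEq N] [Fintype C] [DecidableEq C] [LT C]
    (g : C → ℕ → ℝ) (k : ℕ) (lam : N → ℕ → ℝ) (u : N → C → ℝ) (A : N → Finset C) : Prop :=
  ∀ i, MinimalBestResponse g k (lam i) (u i) A i (A i)

/-- A ballot is sincere if every approved candidate is preferred to every unapproved one. -/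
def Sincere {C : Type*} (u : C → ℝ) (B : Finset C) : Prop :=
  ∀ c ∈ B, ∀ c' ∉ B, u c' < u c

/-- The number of members of `S` with a larger `f`-value than `c` runs exactly through
`0, …, #S - 1` as `c` ranges over `S`. -/
theorem image_card_filter_lt_eq_range {C α : Type*} [LinearOrder α] {f : C → α}
    {S : Finset C} (hf : Set.InjOn f S) :
    S.image (fun c => (S.filter fun c' => f c < f c').card) = range S.card ∧
      Set.InjOn (fun c => (S.filter fun c' => f c < f c').card) S := by
  have hlt : ∀ c ∈ S, ∀ d ∈ S, f c < f d →
      (S.filter fun c' => f d < f c').card < (S.filter fun c' => f c < f c').card := by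
    intro c _ d hd h
    refine card_lt_card ⟨fun x => ?_, fun hsub => ?_⟩
    · simp only [mem_filter]
      exact fun hx => ⟨hx.1, h.trans hx.2⟩
    · exact lt_irrefl _ (mem_filter.1 (hsub (mem_filter.2 ⟨hd, h⟩))).2
  have hinj : Set.InjOn (fun c => (S.filter fun c' => f c < f c').card) S := by
    intro c hc d hd h
    rcases lt_trichotomy (f c) (f d) with h' | h' | h'
    · exact absurd h (hlt c hc d hd h').ne'
    · exact hf hc hd h'
    · exact absurd h (hlt d hd c hc h').ne
  refine ⟨eq_of_subset_of_card_le ?_ ?_, hinj⟩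
  · intro n hn
    obtain ⟨c, hc, rfl⟩ := mem_image.1 hn
    refine mem_range.2 (card_lt_card ⟨filter_subset _ _, fun hsub => ?_⟩)
    exact lt_irrefl _ (mem_filter.1 (hsub hc)).2
  · rw [card_range, card_image_of_injOn hinj]

/-- The OWA utility is monotone: it weakly increases if, for every threshold, the number of
members whose utility reaches the threshold weakly increases. -/
theorem owaUtil_le_owaUtil {C : Type*} {u : C → ℝ} (hu : Function.Injective u)
    {lam : ℕ → ℝ} (hlam : ∀ n, 0 ≤ lam n) {W W' : Finset C} (hcard : W.card = W'.card)
    (hdom : ∀ t, (W.filter fun c => t ≤ u c).card ≤ (W'.filter fun c => t ≤ u c).card) :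
    owaUtil lam u W ≤ owaUtil lam u W' := by
  obtain ⟨himg, hinj⟩ := image_card_filter_lt_eq_range (S := W) hu.injOn
  obtain ⟨himg', hinj'⟩ := image_card_filter_lt_eq_range (S := W') hu.injOn
  have hex : ∀ c ∈ W, ∃ d ∈ W', owaRank u W' d = owaRank u W c := by
    intro c hc
    have h : owaRank u W c ∈ range W'.card := by
      rw [← hcard, ← himg]
      exact mem_image_of_mem _ hc
    rw [← himg'] at h
    exact mem_image.1 h
  choose! σ hσ hrank using hex
  have hσinj : Set.InjOn σ W := fun c hc d hd h =>
    hinj hc hd ((hrank c hc).symm.trans ((congrArg _ h).trans (hrank d hd)))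
  have hle : ∀ c ∈ W, u c ≤ u (σ c) := by
    intro c hc
    by_contra! hlt
    have h₁ : owaRank u W c < (W.filter fun d => u c ≤ u d).card := by
      refine card_lt_card ⟨fun x => ?_, fun hsub => ?_⟩
      · simp only [mem_filter]
        exact fun hx => ⟨hx.1, hx.2.le⟩
      · exact lt_irrefl _ (mem_filter.1 (hsub (mem_filter.2 ⟨hc, le_rfl⟩))).2
    have h₂ : (W'.filter fun d => u c ≤ u d).card ≤ owaRank u W' (σ c) := by
      refine card_le_card fun x => ?_
      simp only [mem_filter]
      exact fun hx => ⟨hx.1, hlt.trans_le hx.2⟩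
    have := hdom (u c)
    have := hrank c hc
    omega
  classical
  have himgσ : W.image σ = W' := by
    refine eq_of_subset_of_card_le (fun x hx => ?_) ?_
    · obtain ⟨c, hc, rfl⟩ := mem_image.1 hx
      exact hσ c hc
    · rw [card_image_of_injOn hσinj, hcard]
  unfold owaUtil
  rw [← himgσ, sum_image hσinj, himgσ]
  refine sum_le_sum fun c hc => ?_
  rw [hrank c hc]
  exact mul_le_mul_of_nonneg_left (hle c hc) (hlam _)

/-- Replacing a committee member by a preferred outsider does not decrease the OWA utility. -/
theorem owaUtil_le_owaUtil_swap {C : Type*} [DecidableEq C] {u : C → ℝ}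
    (hu : Function.Injective u) {lam : ℕ → ℝ} (hlam : ∀ n, 0 ≤ lam n) {W : Finset C} {w x : C}
    (hw : w ∈ W) (hx : x ∉ W) (hwx : u w ≤ u x) :
    owaUtil lam u W ≤ owaUtil lam u (insert x (W.erase w)) := by
  have hx' : x ∉ W.erase w := fun h => hx (mem_of_mem_erase h)
  refine owaUtil_le_owaUtil hu hlam ?_ fun t => ?_
  · rw [card_insert_of_notMem hx', card_erase_add_one hw]
  · nth_rewrite 1 [← insert_erase hw]
    rw [filter_insert, filter_insert]
    have hw' : w ∉ (W.erase w).filter fun c => t ≤ u c := by simp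
    have hx'' : x ∉ (W.erase w).filter fun c => t ≤ u c := fun h => hx' (mem_filter.1 h).1
    split_ifs with h₁ h₂ h₂
    · rw [card_insert_of_notMem hw', card_insert_of_notMem hx'']
    · exact absurd (h₁.trans hwx) h₂
    · exact card_le_card (subset_insert _ _)
    · exact le_rfl

/-- The key by which the best-`k` scoring rule ranks candidates: the value of the scoring
function, with ties broken by priority. -/
def rankKey {N C : Type*} [Fintype N] [LinearOrder C] (g : C → ℕ → ℝ) (A : N → Finset C)
    (c : C) : ℝ ×ₗ Cᵒᵈ :=
  toLex (g c (score A c), OrderDual.toDual c)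

theorem rankKey_injective {N C : Type*} [Fintype N] [LinearOrder C] (g : C → ℕ → ℝ)
    (A : N → Finset C) : Function.Injective (rankKey g A) := fun _ _ h =>
  congrArg (fun p : ℝ ×ₗ Cᵒᵈ => OrderDual.ofDual (ofLex p).2) h

theorem beats_iff_rankKey_lt {N C : Type*} [Fintype N] [LinearOrder C] (g : C → ℕ → ℝ)
    (A : N → Finset C) (c c' : C) : beats g A c c' ↔ rankKey g A c' < rankKey g A c := by
  simp [beats, rankKey, Prod.Lex.toLex_lt_toLex, eq_comm]

theorem mem_winners {N C : Type*} [Fintype N] [Fintype C] [LinearOrder C] {g : C → ℕ → ℝ}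
    {k : ℕ} {A : N → Finset C} {c : C} :
    c ∈ winners g k A ↔
      (univ.filter fun c' => rankKey g A c < rankKey g A c').card < k := by
  simp only [winners, mem_filter, mem_univ, true_and, beats_iff_rankKey_lt]

theorem card_winners {N C : Type*} [Fintype N] [Fintype C] [LinearOrder C] (g : C → ℕ → ℝ)
    {k : ℕ} (hk : k ≤ Fintype.card C) (A : N → Finset C) : (winners g k A).card = k := by
  obtain ⟨himg, hinj⟩ :=
    image_card_filter_lt_eq_range (S := univ) (rankKey_injective g A).injOn
  rw [← card_image_of_injOn (hinj.mono (coe_subset.2 (subset_univ (winners g k A))))]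
  suffices h : (winners g k A).image
      (fun c => (univ.filter fun c' => rankKey g A c < rankKey g A c').card) = range k by
    rw [h, card_range]
  ext n
  simp only [mem_image, mem_winners, mem_range]
  constructor
  · rintro ⟨c, hc, rfl⟩
    exact hc
  · intro hn
    have : n ∈ range (univ : Finset C).card := mem_range.2 (hn.trans_le hk)
    rw [← himg] at this
    obtain ⟨c, -, rfl⟩ := mem_image.1 this
    exact ⟨c, hn, rfl⟩

theorem rankKey_lt_of_mem_winners {N C : Type*} [Fintype N] [Fintype C] [LinearOrder C]
    {g : C → ℕ → ℝ} {k : ℕ} {A : N → Finset C} {w x : C} (hw : w ∈ winners g k A)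
    (hx : x ∉ winners g k A) : rankKey g A x < rankKey g A w := by
  by_contra! h
  refine hx (mem_winners.2 (lt_of_le_of_lt (card_le_card fun y => ?_) (mem_winners.1 hw)))
  simp only [mem_filter, mem_univ, true_and]
  exact h.trans_lt

theorem winners_eq {N C : Type*} [Fintype N] [Fintype C] [LinearOrder C] {g : C → ℕ → ℝ}
    {A : N → Finset C} {W : Finset C}
    (hW : ∀ w ∈ W, ∀ x ∉ W, rankKey g A x < rankKey g A w) : winners g W.card A = W := by
  ext c
  rw [mem_winners]
  constructor
  · intro h
    by_contra hc
    refine h.not_ge (card_le_card fun w hw => ?_)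
    exact mem_filter.2 ⟨mem_univ _, hW w hw c hc⟩
  · intro hc
    refine card_lt_card ⟨fun y hy => ?_, fun hsub => ?_⟩
    · by_contra hy'
      exact (hW c hc y hy').asymm (mem_filter.1 hy).2
    · exact lt_irrefl _ (mem_filter.1 (hsub hc)).2

section Ballot

variable {N C : Type*} [Fintype N] [DecidableEq N] [LinearOrder C]

theorem score_update_congr (A : N → Finset C) (i : N) {B B' : Finset C} {c : C}
    (h : c ∈ B ↔ c ∈ B') : score (Function.update A i B) c = score (Function.update A i B') c := by
  unfold score
  congr 1
  ext j
  by_cases hj : j = i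
  · subst hj
    simp [h]
  · simp [hj]

theorem score_update_mono (A : N → Finset C) (i : N) {B B' : Finset C} {c : C}
    (h : c ∈ B → c ∈ B') :
    score (Function.update A i B) c ≤ score (Function.update A i B') c := by
  refine card_le_card fun j => ?_
  by_cases hj : j = i
  · subst hj
    simpa using h
  · simp [hj]

variable (g : C → ℕ → ℝ) (A : N → Finset C) (i : N)

theorem rankKey_update_congr {B B' : Finset C} {c : C} (h : c ∈ B ↔ c ∈ B') :
    rankKey g (Function.update A i B) c = rankKey g (Function.update A i B') c := by
  rw [rankKey, rankKey, score_update_congr A i h]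

theorem rankKey_update_mono (hg : ∀ c, StrictMono (g c)) {B B' : Finset C} {c : C}
    (h : c ∈ B → c ∈ B') :
    rankKey g (Function.update A i B) c ≤ rankKey g (Function.update A i B') c :=
  Prod.Lex.toLex_mono ⟨(hg c).monotone (score_update_mono A i h), le_rfl⟩

end Ballot

/-- Let `l c` and `h c` be the keys of `c` when the voter disapproves and approves `c`. Among the
`k`-sets `W` that some ballot can elect, one is optimal and elected by a sincere ballot. -/
theorem exists_sincere_optimal {C α : Type*} [Fintype C] [LinearOrder C] [LinearOrder α]
    {l h : C → α} {u : C → ℝ} (hu : Function.Injective u) {lam : ℕ → ℝ}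
    (hlam : ∀ n, 0 ≤ lam n) {k : ℕ}
    (hne : ∃ W : Finset C, W.card = k ∧ ∀ w ∈ W, ∀ x ∉ W, l x < h w) :
    ∃ W B : Finset C, W.card = k ∧ Sincere u B ∧
      (∀ w ∈ W, ∀ x ∉ W, (if x ∈ B then h x else l x) < if w ∈ B then h w else l w) ∧
      ∀ W' : Finset C, W'.card = k → (∀ w ∈ W', ∀ x ∉ W', l x < h w) →
        owaUtil lam u W' ≤ owaUtil lam u W := by
  classical
  obtain ⟨W, hW, hmax⟩ := exists_max_image
    (univ.filter fun W : Finset C => W.card = k ∧ ∀ w ∈ W, ∀ x ∉ W, l x < h w)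
    (fun W => toLex (owaUtil lam u W, ∑ c ∈ W, u c))
    (hne.imp fun W hW => mem_filter.2 ⟨mem_univ _, hW⟩)
  obtain ⟨hcard, hW⟩ := (mem_filter.1 hW).2
  simp only [mem_filter, mem_univ, true_and, and_imp] at hmax
  refine ⟨W, univ.filter fun c => ∃ q ∈ W, (∃ y ∉ W, l q ≤ l y) ∧ u q ≤ u c, hcard, ?_, ?_, ?_⟩
  · intro c hc c' hc'
    simp only [mem_filter, mem_univ, true_and] at hc hc'
    obtain ⟨q, hq, hy, hqc⟩ := hc
    by_contra! hcc'
    exact hc' ⟨q, hq, hy, hqc.trans hcc'⟩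
  · intro w hw x hx
    have key : ∀ y ∉ W, l y < if w ∈ univ.filter (fun c => ∃ q ∈ W, (∃ y ∉ W, l q ≤ l y) ∧
        u q ≤ u c) then h w else l w := by
      intro y hy
      split_ifs with hwB
      · exact hW w hw y hy
      · by_contra! hwy
        exact hwB (mem_filter.2 ⟨mem_univ _, w, hw, ⟨y, hy, hwy⟩, le_rfl⟩)
    by_cases hxB : x ∈ univ.filter (fun c => ∃ q ∈ W, (∃ y ∉ W, l q ≤ l y) ∧ u q ≤ u c)
    · rw [if_pos hxB]
      obtain ⟨q, hq, ⟨y, hy, hqy⟩, hqx⟩ := (mem_filter.1 hxB).2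
      suffices hbound : ∃ z ∉ W, h x ≤ l z by
        obtain ⟨z, hz, hxz⟩ := hbound
        exact hxz.trans_lt (key z hz)
      by_contra! hlarge
      have hxq : x ∉ W.erase q := fun hmem => hx (mem_of_mem_erase hmem)
      have hqx' : u q < u x := hqx.lt_of_ne fun he => hx (hu he ▸ hq)
      have hswap := hmax (insert x (W.erase q))
        (by rw [card_insert_of_notMem hxq, card_erase_add_one hq, hcard]) ?_
      · rw [Prod.Lex.toLex_le_toLex] at hswap
        rcases hswap with hlt | ⟨-, hle⟩
        · exact hlt.not_ge (owaUtil_le_owaUtil_swap hu hlam hq hx hqx)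
        · have hsum := sum_erase_add W u hq
          simp only [sum_insert hxq] at hle
          linarith
      · have hall : ∀ v ∈ insert x (W.erase q), ∀ z ∉ W, l z < h v := by
          intro v hv z hz
          rcases mem_insert.1 hv with rfl | hv
          · exact hlarge z hz
          · exact hW v (mem_of_mem_erase hv) z hz
        intro v hv z hz
        by_cases hzW : z ∈ W
        · have hzq : z = q := by
            by_contra hne
            exact hz (mem_insert_of_mem (mem_erase.2 ⟨hne, hzW⟩))
          exact hzq ▸ hqy.trans_lt (hall v hv y hy)
        · exact hall v hv z hzW
    · rw [if_neg hxB]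
      exact key x hx
  · intro W' hcard' hW'
    rcases Prod.Lex.toLex_le_toLex.1 (hmax W' hcard' hW') with hlt | ⟨heq, -⟩
    exacts [hlt.le, heq.le]

/-- for every voter and every profile of the other voters' ballots there exists
a ballot that is both sincere and a best response. -/
theorem statement_17 {N C : Type*} [Fintype N] [DecidableEq N] [Fintype C] [LinearOrder C]
    (k : ℕ) (hk1 : 1 ≤ k) (hk2 : k ≤ Fintype.card C)
    (g : C → ℕ → ℝ) (hg : ∀ c, StrictMono (g c)) (hg0 : ∀ c, g c 0 = 0)
    (u : C → ℝ) (hu : Function.Injective u)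
    (lam : ℕ → ℝ) (hlam : ∀ n, 0 ≤ lam n) (hlamne : ∃ n < k, lam n ≠ 0)
    (A : N → Finset C) (i : N) :
    ∃ B : Finset C, Sincere u B ∧ BestResponse g k lam u A i B := by
  have hkey : ∀ B c, rankKey g (Function.update A i B) c =
      if c ∈ B then rankKey g (Function.update A i univ) c
      else rankKey g (Function.update A i ∅) c := by
    intro B c
    split_ifs with h
    · exact rankKey_update_congr g A i (by simp [h])
    · exact rankKey_update_congr g A i (by simp [h])
  have hatt : ∀ B, ∀ w ∈ winners g k (Function.update A i B),
      ∀ x ∉ winners g k (Function.update A i B),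
        rankKey g (Function.update A i ∅) x < rankKey g (Function.update A i univ) w := by
    intro B w hw x hx
    calc rankKey g (Function.update A i ∅) x
        ≤ rankKey g (Function.update A i B) x := rankKey_update_mono g A i hg (by simp)
      _ < rankKey g (Function.update A i B) w := rankKey_lt_of_mem_winners hw hx
      _ ≤ rankKey g (Function.update A i univ) w := rankKey_update_mono g A i hg (by simp)
  obtain ⟨W, B, hcard, hB, hsep, hopt⟩ := exists_sincere_optimal hu hlam
    ⟨winners g k (Function.update A i ∅), card_winners g hk2 _, hatt ∅⟩
  refine ⟨B, hB, fun B' => ?_⟩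
  have hwin : winners g k (Function.update A i B) = W := by
    rw [← hcard]
    refine winners_eq fun w hw x hx => ?_
    rw [hkey B x, hkey B w]
    exact hsep w hw x hx
  rw [hwin]
  exact hopt _ (card_winners g hk2 _) (hatt B')
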